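/- arXiv:2510.14019 — 2 statements merged into one kernel-verified Lean document; each statement's English description precedes it below -/
import Mathlib

section
/- Existence of a separating scale (Remark 4.4 of the paper): Suppose (d_t)_{t∈I} satisfies condition (RF4) with constant K ≥ 1, that I is unbounded below, and that t ↦ d_t(x,y) is continuous on I for all x,y ∈ M. Let 0 < τ ≤ 1 and R > 0 with τ²R ≥ 2K. Let p, x, y ∈ M with d_{−1}(p,x) < 2R and d_{−1}(p,y) < 2R (i.e. x, y ∈ B̃_{2R}(p,1)), let 0 < r_x, r_y < 1, and suppose that the balls B̃_{τ²R}(x, r_x) and B̃_{τ²R}(y, r_y) are disjoint. Then there exists σ ∈ [τ²R, 4R] such that max(r_x, r_y) ≤ D_σ(x,y) < 1. -/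
open scoped ENNReal

noncomputable section

/-- A family of distance functions `d t x y` on a set `M`, indexed by times `t` in a
set `I ⊆ ℝ` which is a nonempty interval with supremum `0`, such that `d t` is a
metric on `M` for every `t ∈ I`. -/
structure FlowMetric (M : Type*) (I : Set ℝ) where
  d : ℝ → M → M → ℝ
  ordConnected : I.OrdConnected
  nonempty : I.Nonempty
  isLUB_zero : IsLUB I 0
  d_self : ∀ t ∈ I, ∀ x : M, d t x x = 0
  eq_of_d_eq_zero : ∀ t ∈ I, ∀ x y : M, d t x y = 0 → x = y
  d_symm : ∀ t ∈ I, ∀ x y : M, d t x y = d t y x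
  d_triangle : ∀ t ∈ I, ∀ x y z : M, d t x z ≤ d t x y + d t y z

/-- Condition (RF4): the lower distance-distortion estimate with constant `K ≥ 1`:
`d_s(x,y) ≤ d_t(x,y) + K(√|s| − √|t|)` for all `s < t` in `I`. -/
def RF4 {M : Type*} {I : Set ℝ} (fm : FlowMetric M I) (K : ℝ) : Prop :=
  1 ≤ K ∧ ∀ x y : M, ∀ s ∈ I, ∀ t ∈ I, s < t →
    fm.d s x y ≤ fm.d t x y + K * (Real.sqrt |s| - Real.sqrt |t|)

/-- The set `I^ρ_{x,y}` of admissible scales: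
`{r > 0 : −r² ∈ I and d_{−r²}(x,y) < ρ·r}`. -/
def scaleSet {M : Type*} {I : Set ℝ} (fm : FlowMetric M I) (ρ : ℝ) (x y : M) : Set ℝ :=
  {r : ℝ | 0 < r ∧ -r ^ 2 ∈ I ∧ fm.d (-r ^ 2) x y < ρ * r}

/-- The `ρ`-scale `D_ρ(x,y) = inf I^ρ_{x,y} ∈ [0,+∞]`, equal to `+∞` when
`I^ρ_{x,y} = ∅`. -/
def Dscale {M : Type*} {I : Set ℝ} (fm : FlowMetric M I) (ρ : ℝ) (x y : M) : ℝ≥0∞ :=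
  ⨅ r ∈ scaleSet fm ρ x y, ENNReal.ofReal r

/-- The ball `B̃_ρ(x,r) = {y : d_{−r²}(x,y) < ρ·r}`. -/
def tball {M : Type*} {I : Set ℝ} (fm : FlowMetric M I) (ρ : ℝ) (x : M) (r : ℝ) : Set M :=
  {y : M | fm.d (-r ^ 2) x y < ρ * r}

theorem FlowMetric.mem_of_neg {M : Type*} {I : Set ℝ} (fm : FlowMetric M I)
    (hI : ¬ BddBelow I) {t : ℝ} (ht : t < 0) : t ∈ I := by
  obtain ⟨a, ha, hat⟩ := not_bddBelow_iff.1 hI t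
  obtain ⟨b, hb, htb, -⟩ := fm.isLUB_zero.exists_between ht
  exact fm.ordConnected.out ha hb ⟨hat.le, htb.le⟩

theorem RF4.d_neg_sq_le {M : Type*} {I : Set ℝ} {fm : FlowMetric M I} {K : ℝ}
    (h : RF4 fm K) (x y : M) {r s : ℝ} (hr : 0 < r) (hrs : r < s)
    (hrI : -r ^ 2 ∈ I) (hsI : -s ^ 2 ∈ I) :
    fm.d (-s ^ 2) x y ≤ fm.d (-r ^ 2) x y + K * (s - r) := by
  have hs : 0 < s := hr.trans hrs
  have h1 := h.2 x y _ hsI _ hrI (neg_lt_neg (by gcongr))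
  simpa [abs_neg, Real.sqrt_sq_eq_abs, abs_of_pos hr, abs_of_pos hs] using h1

theorem ofReal_le_Dscale {M : Type*} {I : Set ℝ} {fm : FlowMetric M I} {ρ a : ℝ} {x y : M}
    (h : ∀ r ∈ scaleSet fm ρ x y, a ≤ r) : ENNReal.ofReal a ≤ Dscale fm ρ x y :=
  le_iInf₂ fun r hr => ENNReal.ofReal_le_ofReal (h r hr)

theorem Dscale_lt_one {M : Type*} {I : Set ℝ} (fm : FlowMetric M I) (hI : ¬ BddBelow I)
    {x y : M} (hcont : ContinuousOn (fun t => fm.d t x y) I) {ρ : ℝ}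
    (h : fm.d (-1) x y < ρ) : Dscale fm ρ x y < 1 := by
  have hmem : I ∈ nhds (-(1 : ℝ) ^ 2) :=
    Filter.mem_of_superset (Iio_mem_nhds (by norm_num : -(1 : ℝ) ^ 2 < 0))
      fun t ht => fm.mem_of_neg hI ht
  have hc : ContinuousAt (fun r : ℝ => fm.d (-r ^ 2) x y) 1 :=
    ContinuousAt.comp (f := fun r : ℝ => -r ^ 2) (g := fun t => fm.d t x y)
      (hcont.continuousAt hmem) (by fun_prop)
  have hlt : ∀ᶠ r : ℝ in nhds 1, fm.d (-r ^ 2) x y < ρ * r :=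
    hc.eventually_lt (by fun_prop) (by simpa using h)
  obtain ⟨r, ⟨hr, hr0⟩, hr1⟩ := (((hlt.and (lt_mem_nhds one_pos)).filter_mono
    nhdsWithin_le_nhds).and (self_mem_nhdsWithin (s := Set.Iio (1 : ℝ)))).exists
  have hrS : r ∈ scaleSet fm ρ x y :=
    ⟨hr0, fm.mem_of_neg hI (neg_lt_zero.2 (pow_pos hr0 2)), hr⟩
  exact (iInf₂_le r hrS).trans_lt (ENNReal.ofReal_lt_one.2 hr1)

theorem le_d_of_disjoint_tball {M : Type*} {I : Set ℝ} (fm : FlowMetric M I)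
    {ρ r s : ℝ} {x y : M} (hρ : 0 < ρ) (hs : 0 < s) (hsI : -s ^ 2 ∈ I)
    (h : Disjoint (tball fm ρ x r) (tball fm ρ y s)) : ρ * r ≤ fm.d (-r ^ 2) x y := by
  by_contra! hlt
  refine Set.disjoint_left.1 h (show y ∈ tball fm ρ x r from hlt) ?_
  change fm.d (-s ^ 2) y y < ρ * s
  rw [fm.d_self _ hsI]
  positivity

/-- **Existence of a separating scale** (Remark 4.4 of the paper). Assume (RF4)
with constant `K ≥ 1`, `I` unbounded below, and `t ↦ d_t(x,y)` continuous on `I`.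
Let `0 < τ ≤ 1` and `R > 0` with `τ²R ≥ 2K`; let `p, x, y ∈ M` with
`x, y ∈ B̃_{2R}(p,1)`, let `0 < r_x, r_y < 1`, and suppose the balls
`B̃_{τ²R}(x, r_x)` and `B̃_{τ²R}(y, r_y)` are disjoint. Then there exists
`σ ∈ [τ²R, 4R]` with `max(r_x, r_y) ≤ D_σ(x,y) < 1`. -/
theorem exists_separating_scale
    {M : Type*} {I : Set ℝ} (fm : FlowMetric M I) {K : ℝ} (hRF4 : RF4 fm K)
    (hI : ¬ BddBelow I)
    (hcont : ∀ x y : M, ContinuousOn (fun t => fm.d t x y) I)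
    {τ R : ℝ} (hτ0 : 0 < τ) (hτ1 : τ ≤ 1) (hR0 : 0 < R) (hτR : 2 * K ≤ τ ^ 2 * R)
    (p x y : M) (hx : x ∈ tball fm (2 * R) p 1) (hy : y ∈ tball fm (2 * R) p 1)
    {rx ry : ℝ} (hrx0 : 0 < rx) (hrx1 : rx < 1) (hry0 : 0 < ry) (hry1 : ry < 1)
    (hdisj : Disjoint (tball fm (τ ^ 2 * R) x rx) (tball fm (τ ^ 2 * R) y ry)) :
    ∃ σ : ℝ, τ ^ 2 * R ≤ σ ∧ σ ≤ 4 * R ∧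
      ENNReal.ofReal (max rx ry) ≤ Dscale fm σ x y ∧ Dscale fm σ x y < 1 := by
  have hK : 1 ≤ K := hRF4.1
  have hmem : ∀ r : ℝ, 0 < r → -r ^ 2 ∈ I := fun r hr =>
    fm.mem_of_neg hI (neg_lt_zero.2 (pow_pos hr 2))
  have hone : (-1 : ℝ) ∈ I := by simpa using hmem 1 one_pos
  have hxy : fm.d (-1) x y < 4 * R := by
    have h1 : fm.d (-1) p x < 2 * R := by simpa [tball] using hx
    have h2 : fm.d (-1) p y < 2 * R := by simpa [tball] using hy
    have h3 := fm.d_triangle (-1) hone x p y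
    rw [fm.d_symm (-1) hone x p] at h3
    linarith
  have hτ2 : τ ^ 2 ≤ 1 := pow_le_one₀ hτ0.le hτ1
  rcases lt_or_ge (fm.d (-1) x y) (τ ^ 2 * R) with hlt | hge
  · refine ⟨τ ^ 2 * R, le_rfl, by nlinarith, ofReal_le_Dscale ?_,
      Dscale_lt_one fm hI (hcont x y) hlt⟩
    have hlower : ∀ s : ℝ, 0 < s → τ ^ 2 * R * s ≤ fm.d (-s ^ 2) x y →
        ∀ r ∈ scaleSet fm (τ ^ 2 * R) x y, s ≤ r := by
      rintro s hs hds r ⟨hr0, hrI, hr⟩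
      by_contra! hrs
      have := hRF4.d_neg_sq_le x y hr0 hrs hrI (hmem s hs)
      nlinarith
    have hρ : 0 < τ ^ 2 * R := by positivity
    have hdx := le_d_of_disjoint_tball fm hρ hry0 (hmem ry hry0) hdisj
    have hdy := le_d_of_disjoint_tball fm hρ hrx0 (hmem rx hrx0) hdisj.symm
    rw [fm.d_symm _ (hmem ry hry0)] at hdy
    exact fun r hr => max_le (hlower rx hrx0 hdx r hr) (hlower ry hry0 hdy r hr)
  · have ha1 : max rx ry < 1 := max_lt hrx1 hry1
    set a := max rx ry
    obtain ⟨σ, hσ, hσ'⟩ := exists_between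
      (lt_min hxy (lt_add_of_pos_right (fm.d (-1) x y)
        (mul_pos (by linarith : 0 < K) (sub_pos.2 ha1))))
    obtain ⟨hσR, hσa⟩ := lt_min_iff.1 hσ'
    refine ⟨σ, hge.trans hσ.le, hσR.le, ofReal_le_Dscale ?_,
      Dscale_lt_one fm hI (hcont x y) hσ⟩
    rintro r ⟨hr0, hrI, hr⟩
    by_contra! hra
    have h1 := hRF4.d_neg_sq_le x y hr0 (hra.trans ha1) hrI (hmem 1 one_pos)
    rw [one_pow] at h1
    have h2 : K * (1 - a) ≤ (σ - K) * (1 - r) :=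
      mul_le_mul (by linarith) (by linarith) (by linarith) (by linarith)
    linarith
end
end

section
/- The radius function of the constructed neck region is (1.01, δ)-Lipschitz (estimate (r_lip_S) in the proof of Lemma 5.2): Suppose (d_t)_{t∈I} satisfies condition (RF4) with constant K ≥ 1 and that I is unbounded below, and let 0 < τ ≤ 1. There exist R₀ < +∞ depending only on τ and K, and δ₀ > 0 depending only on τ, with the following property. Let R ≥ R₀ and 0 < δ ≤ δ₀; let C̃ ⊆ M be a nonempty finite set and r̃ : C̃ → (0,∞) be such that the balls B̃_{τ⁴R}(z, r̃_z), z ∈ C̃, are mutually disjoint; and set S = ⋃_{z∈C̃} B̃_{τ²R}(z, r̃_z). Define r : S → (0,+∞) by r_x = (δ²/4)·r̃_{x̃} if there is x̃ ∈ C̃ with D_{τ⁴R}(x, x̃) < r̃_{x̃}/4 (such x̃ is then unique), and r_x = δ²·min_{z∈C̃} D_{τ⁴R}(x, z) otherwise (this minimum being finite and positive). Then r is R-scale (1.01, δ)-Lipschitz on S: for all x, y ∈ S, r_x ≤ 1.01·r_y + δ·D_R(x,y). -/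
open scoped ENNReal

noncomputable section

universe u

namespace FlowMetric

variable {M : Type*} {I : Set ℝ}

lemma neg_sq_mem (fm : FlowMetric M I) (hI : ¬ BddBelow I) {r : ℝ} (hr : 0 < r) :
    -r ^ 2 ∈ I := by
  obtain ⟨s, hs, hsr⟩ := not_bddBelow_iff.1 hI (-r ^ 2)
  obtain ⟨t, ht, htr⟩ := (lt_isLUB_iff fm.isLUB_zero).1 (show -r ^ 2 < 0 by nlinarith)
  exact fm.ordConnected.out hs ht ⟨hsr.le, htr.le⟩

lemma d_nonneg (fm : FlowMetric M I) {t : ℝ} (ht : t ∈ I) (x y : M) : 0 ≤ fm.d t x y := by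
  have h₁ := fm.d_triangle t ht x y x
  rw [fm.d_self t ht, fm.d_symm t ht y x] at h₁
  linarith

end FlowMetric

section

variable {M : Type*} {I : Set ℝ} {fm : FlowMetric M I} {K ρ : ℝ}

lemma RF4.d_le (h : RF4 fm K) (hI : ¬ BddBelow I) {a b : ℝ} (ha : 0 < a) (hab : a ≤ b)
    (x y : M) : fm.d (-b ^ 2) x y ≤ fm.d (-a ^ 2) x y + K * (b - a) := by
  rcases hab.eq_or_lt with rfl | hlt
  · simp
  · have key := h.2 x y _ (fm.neg_sq_mem hI (ha.trans hlt)) _ (fm.neg_sq_mem hI ha)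
      (show -b ^ 2 < -a ^ 2 by nlinarith)
    rwa [abs_neg, abs_neg, abs_of_nonneg (sq_nonneg b), abs_of_nonneg (sq_nonneg a),
      Real.sqrt_sq (ha.trans hlt).le, Real.sqrt_sq ha.le] at key

lemma Dscale_le_ofReal (hI : ¬ BddBelow I) {x y : M} {r : ℝ} (hr : 0 < r)
    (h : fm.d (-r ^ 2) x y < ρ * r) : Dscale fm ρ x y ≤ ENNReal.ofReal r :=
  iInf₂_le r ⟨hr, fm.neg_sq_mem hI hr, h⟩

lemma RF4.Dscale_ne_top (h : RF4 fm K) (hI : ¬ BddBelow I) (hρ : K < ρ) (x y : M) :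
    Dscale fm ρ x y ≠ ⊤ := by
  have hd := fm.d_nonneg (fm.neg_sq_mem hI one_pos) x y
  have hpos : 0 < ρ - K := sub_pos.2 hρ
  set r : ℝ := 1 + fm.d (-1 ^ 2) x y / (ρ - K) with hr
  have hr1 : 1 ≤ r := by
    have : 0 ≤ fm.d (-1 ^ 2) x y / (ρ - K) := by positivity
    linarith
  have hmul : (r - 1) * (ρ - K) = fm.d (-1 ^ 2) x y := by
    rw [hr]
    field_simp
    ring
  have hle := h.d_le hI one_pos hr1 x y
  refine ((Dscale_le_ofReal (ρ := ρ) (r := r) hI (by linarith) ?_).trans_lt ENNReal.ofReal_lt_top).ne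
  nlinarith [h.1]

lemma Dscale_toReal_le (hI : ¬ BddBelow I) {x y : M} {r : ℝ} (hr : 0 < r)
    (h : fm.d (-r ^ 2) x y < ρ * r) : (Dscale fm ρ x y).toReal ≤ r :=
  ENNReal.toReal_le_of_le_ofReal hr.le (Dscale_le_ofReal hI hr h)

lemma RF4.d_lt_of_Dscale_lt (h : RF4 fm K) (hI : ¬ BddBelow I) (hρ : K < ρ) {x y : M} {r : ℝ}
    (hr : (Dscale fm ρ x y).toReal < r) : fm.d (-r ^ 2) x y < ρ * r := by
  have hlt : Dscale fm ρ x y < ENNReal.ofReal r :=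
    (ENNReal.lt_ofReal_iff_toReal_lt (h.Dscale_ne_top hI hρ x y)).2 hr
  obtain ⟨a, ha⟩ := iInf_lt_iff.1 hlt
  obtain ⟨⟨ha0, -, had⟩, har⟩ := iInf_lt_iff.1 ha
  have har' : a < r := (ENNReal.ofReal_lt_ofReal_iff_of_nonneg ha0.le).1 har
  have hle := h.d_le hI ha0 har'.le x y
  nlinarith

lemma Dscale_comm (fm : FlowMetric M I) (ρ : ℝ) (x y : M) :
    Dscale fm ρ x y = Dscale fm ρ y x := by
  have : scaleSet fm ρ x y = scaleSet fm ρ y x := by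
    ext r
    refine and_congr_right fun _ => and_congr_right fun hr => ?_
    rw [fm.d_symm _ hr]
  rw [Dscale, Dscale, this]

lemma RF4.Dscale_triangle (h : RF4 fm K) (hI : ¬ BddBelow I) (hρ : 102 * K ≤ ρ) (x y z : M) :
    (Dscale fm ρ x z).toReal ≤
      1.01 * ((Dscale fm ρ x y).toReal + (Dscale fm ρ y z).toReal) := by
  have hK := h.1
  have hKρ : K < ρ := by linarith
  refine le_of_forall_pos_le_add fun ε hε => ?_
  obtain ⟨a, hea⟩ : ∃ a, a = (Dscale fm ρ x y).toReal + ε / 4 := ⟨_, rfl⟩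
  obtain ⟨b, heb⟩ : ∃ b, b = (Dscale fm ρ y z).toReal + ε / 4 := ⟨_, rfl⟩
  have ha : 0 < a := by
    have := ENNReal.toReal_nonneg (a := Dscale fm ρ x y)
    linarith
  have hb : 0 < b := by
    have := ENNReal.toReal_nonneg (a := Dscale fm ρ y z)
    linarith
  have hxy := h.d_lt_of_Dscale_lt hI hKρ (show (Dscale fm ρ x y).toReal < a by linarith)
  have hyz := h.d_lt_of_Dscale_lt hI hKρ (show (Dscale fm ρ y z).toReal < b by linarith)
  have hxy' := h.d_le hI ha (show a ≤ 1.01 * (a + b) by linarith) x y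
  have hyz' := h.d_le hI hb (show b ≤ 1.01 * (a + b) by linarith) y z
  have hpos : 0 < 1.01 * (a + b) := by positivity
  have htri := fm.d_triangle _ (fm.neg_sq_mem hI hpos) x y z
  have hlt : fm.d (-(1.01 * (a + b)) ^ 2) x z < ρ * (1.01 * (a + b)) := by
    nlinarith [mul_nonneg (sub_nonneg.2 hρ) (add_pos ha hb).le]
  have := Dscale_toReal_le hI hpos hlt
  linarith

lemma RF4.Dscale_mul_le (h : RF4 fm K) (hI : ¬ BddBelow I) {σ R : ℝ} (hσ0 : 0 < σ) (hσ1 : σ ≤ 1)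
    (hR : 2 * K ≤ σ * R) (x y : M) :
    σ * (Dscale fm (σ * R) x y).toReal ≤ 2 * (Dscale fm R x y).toReal := by
  have hK := h.1
  have hR0 : 0 < R := pos_of_mul_pos_right (by linarith) hσ0.le
  have hKR : K < R := by nlinarith
  refine le_of_forall_pos_le_add fun ε hε => ?_
  obtain ⟨a, hea⟩ : ∃ a, a = (Dscale fm R x y).toReal + ε / 2 := ⟨_, rfl⟩
  have ha : 0 < a := by
    have := ENNReal.toReal_nonneg (a := Dscale fm R x y)
    linarith
  have hd := h.d_lt_of_Dscale_lt hI hKR (show (Dscale fm R x y).toReal < a by linarith)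
  obtain ⟨b, heb⟩ : ∃ b, b = 2 * a / σ := ⟨_, rfl⟩
  have hb : σ * b = 2 * a := by rw [heb]; field_simp
  have hab : a ≤ b := by
    rw [heb, le_div_iff₀ hσ0]
    nlinarith
  have hd' := h.d_le hI ha hab x y
  have hlt : fm.d (-b ^ 2) x y < σ * R * b := by
    have h₁ : 2 * K * b ≤ σ * R * b := mul_le_mul_of_nonneg_right hR (ha.le.trans hab)
    have h₂ : σ * R * b = 2 * (R * a) := by linear_combination R * hb
    have h₃ : 0 < K * a := by positivity
    linarith
  have := mul_le_mul_of_nonneg_left (Dscale_toReal_le hI (ha.trans_le hab) hlt) hσ0.le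
  linarith

lemma RF4.le_Dscale_of_disjoint (h : RF4 fm K) (hI : ¬ BddBelow I) (hρ : K < ρ) {z w : M}
    {a b : ℝ} (hb : 0 < b) (hd : Disjoint (tball fm ρ z a) (tball fm ρ w b)) :
    a ≤ (Dscale fm ρ z w).toReal := by
  by_contra! hlt
  refine Set.disjoint_left.1 hd (h.d_lt_of_Dscale_lt hI hρ hlt) ?_
  have := h.1
  rw [tball, Set.mem_ofPred_eq, fm.d_self _ (fm.neg_sq_mem hI hb)]
  exact mul_pos (by linarith) hb

/-- Two points close to the centres of disjoint balls, relative to `m ≤ D_ρ(z,w)`, are at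
`ρ`-scale distance at least `m / 4`. -/
lemma RF4.le_Dscale_of_near (h : RF4 fm K) (hI : ¬ BddBelow I) (hρ : 102 * K ≤ ρ) {x y z w : M}
    {m : ℝ} (hm : m ≤ (Dscale fm ρ z w).toReal) (hx : (Dscale fm ρ x z).toReal ≤ m / 4)
    (hy : (Dscale fm ρ y w).toReal ≤ m / 4) : m / 4 ≤ (Dscale fm ρ x y).toReal := by
  have h₁ := h.Dscale_triangle hI hρ z x w
  have h₂ := h.Dscale_triangle hI hρ x y w
  rw [Dscale_comm fm ρ z x] at h₁
  have := ENNReal.toReal_nonneg (a := Dscale fm ρ x z)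
  linarith

end

/-- **The radius function of the constructed neck region is (1.01, δ)-Lipschitz**
(estimate (r_lip_S) in the proof of Lemma 5.2). For every `0 < τ ≤ 1` there is
`δ₀ > 0` (depending only on `τ`), and for every `K ≥ 1` there is `R₀ < ∞`
(depending only on `τ` and `K`), such that: for every family `(d_t)` on a set `M`
satisfying (RF4) with constant `K` and with `I` unbounded below, every `R ≥ R₀`,
`0 < δ ≤ δ₀`, every nonempty finite `C̃ ⊆ M` with radii `r̃_z > 0` whose balls
`B̃_{τ⁴R}(z, r̃_z)` are mutually disjoint, and `S = ⋃_{z∈C̃} B̃_{τ²R}(z, r̃_z)`,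
any function `r` on `S` defined by `r_x = (δ²/4)·r̃_{x̃}` if some (necessarily
unique) `x̃ ∈ C̃` has `D_{τ⁴R}(x, x̃) < r̃_{x̃}/4`, and
`r_x = δ²·inf_{z∈C̃} D_{τ⁴R}(x, z)` otherwise, is R-scale `(1.01, δ)`-Lipschitz
on `S`: `r_x ≤ 1.01·r_y + δ·D_R(x,y)` for all `x, y ∈ S`. -/
theorem neck_radius_lipschitz (τ : ℝ) (hτ0 : 0 < τ) (hτ1 : τ ≤ 1) :
    ∃ δ₀ > (0 : ℝ), ∀ K : ℝ, 1 ≤ K → ∃ R₀ : ℝ,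
      ∀ (M : Type u) (I : Set ℝ) (fm : FlowMetric M I),
        RF4 fm K → ¬ BddBelow I →
        ∀ R : ℝ, R₀ ≤ R → ∀ δ : ℝ, 0 < δ → δ ≤ δ₀ →
        ∀ Ct : Finset M, Ct.Nonempty →
        ∀ rt : M → ℝ, (∀ z ∈ Ct, 0 < rt z) →
        ((Ct : Set M).Pairwise (fun z w =>
          Disjoint (tball fm (τ ^ 4 * R) z (rt z)) (tball fm (τ ^ 4 * R) w (rt w)))) →
        ∀ r : M → ℝ,
        (∀ x ∈ ⋃ z ∈ Ct, tball fm (τ ^ 2 * R) z (rt z),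
          (∃ xt ∈ Ct, Dscale fm (τ ^ 4 * R) x xt < ENNReal.ofReal (rt xt / 4) ∧
              r x = δ ^ 2 / 4 * rt xt) ∨
          ((¬ ∃ xt ∈ Ct, Dscale fm (τ ^ 4 * R) x xt < ENNReal.ofReal (rt xt / 4)) ∧
            ENNReal.ofReal (r x) =
              ENNReal.ofReal (δ ^ 2) * ⨅ z ∈ (Ct : Set M), Dscale fm (τ ^ 4 * R) x z)) →
        ∀ x ∈ ⋃ z ∈ Ct, tball fm (τ ^ 2 * R) z (rt z),
        ∀ y ∈ ⋃ z ∈ Ct, tball fm (τ ^ 2 * R) z (rt z),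
          ENNReal.ofReal (r x) ≤
            ENNReal.ofReal (1.01 * r y) + ENNReal.ofReal δ * Dscale fm R x y := by
  refine ⟨τ ^ 4 / 4, by positivity, fun K hK => ⟨102 * K / τ ^ 4, ?_⟩⟩
  intro M I fm h hI R hR δ hδ0 hδ Ct hne rt hrt hdisj r hr x hx y hy
  have hσ0 : 0 < τ ^ 4 := by positivity
  have hσ1 : τ ^ 4 ≤ 1 := pow_le_one₀ hτ0.le hτ1
  have hρ : 102 * K ≤ τ ^ 4 * R := by rwa [div_le_iff₀' hσ0] at hR
  have hR0 : 0 < R := pos_of_mul_pos_right (by linarith) hσ0.le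
  have hKρ : K < τ ^ 4 * R := by linarith
  have hKR : K < R := by nlinarith
  have hfin := h.Dscale_ne_top hI hKρ
  set D : M → M → ℝ := fun p q => (Dscale fm (τ ^ 4 * R) p q).toReal with hD
  have hD0 : ∀ p q, 0 ≤ D p q := fun p q => ENNReal.toReal_nonneg
  have htri : ∀ p q s, D p s ≤ 1.01 * (D p q + D q s) := h.Dscale_triangle hI hρ
  have hsep : ∀ z ∈ Ct, ∀ w ∈ Ct, z ≠ w → rt z ≤ D z w := fun z hz w hw hzw =>
    h.le_Dscale_of_disjoint hI hKρ (hrt w hw) (hdisj hz hw hzw)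
  have hnear : ∀ p q, Dscale fm (τ ^ 4 * R) p q < ENNReal.ofReal (rt q / 4) ↔ D p q < rt q / 4 :=
    fun p q => ENNReal.lt_ofReal_iff_toReal_lt (hfin p q)
  have hcase : ∀ p ∈ ⋃ z ∈ Ct, tball fm (τ ^ 2 * R) z (rt z),
      (∃ z ∈ Ct, D p z < rt z / 4 ∧ max (r p) 0 = δ ^ 2 / 4 * rt z) ∨
      ((∀ z ∈ Ct, rt z / 4 ≤ D p z) ∧
        ∃ w ∈ Ct, (∀ z ∈ Ct, D p w ≤ D p z) ∧ max (r p) 0 = δ ^ 2 * D p w) := by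
    intro p hp
    rcases hr p hp with ⟨z, hz, hlt, hrp⟩ | ⟨hnot, hrp⟩
    · refine Or.inl ⟨z, hz, (hnear p z).1 hlt, ?_⟩
      rw [hrp, max_eq_left (mul_nonneg (by positivity) (hrt z hz).le)]
    · refine Or.inr ⟨fun z hz => not_lt.1 fun hlt => hnot ⟨z, hz, (hnear p z).2 hlt⟩, ?_⟩
      obtain ⟨w, hw, hmin⟩ := Ct.exists_min_image (fun z => Dscale fm (τ ^ 4 * R) p z) hne
      refine ⟨w, hw, fun z hz => ENNReal.toReal_mono (hfin p z) (hmin z hz), ?_⟩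
      have hinf : ⨅ z ∈ (Ct : Set M), Dscale fm (τ ^ 4 * R) p z = Dscale fm (τ ^ 4 * R) p w :=
        le_antisymm (iInf₂_le w hw) (le_iInf₂ hmin)
      rw [hinf] at hrp
      have := congrArg ENNReal.toReal hrp
      rwa [ENNReal.toReal_mul, ENNReal.toReal_ofReal', ENNReal.toReal_ofReal (sq_nonneg δ)] at this
  have hcmp : 2 * δ ^ 2 * D x y ≤ δ * (Dscale fm R x y).toReal := by
    have h₁ := h.Dscale_mul_le hI hσ0 hσ1 (show 2 * K ≤ τ ^ 4 * R by linarith) x y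
    have h₂ : 4 * δ * D x y ≤ τ ^ 4 * D x y :=
      mul_le_mul_of_nonneg_right (by linarith) (hD0 x y)
    have h₃ : 2 * δ * D x y ≤ (Dscale fm R x y).toReal := by linarith
    calc 2 * δ ^ 2 * D x y = δ * (2 * δ * D x y) := by ring
      _ ≤ _ := mul_le_mul_of_nonneg_left h₃ hδ0.le
  have hsq : 0 < δ ^ 2 := by positivity
  have hy0 := le_max_right (r y) 0
  have hxy0 : 0 ≤ δ ^ 2 * D x y := mul_nonneg hsq.le (hD0 x y)
  have hmain : max (r x) 0 ≤ 1.01 * max (r y) 0 + δ * (Dscale fm R x y).toReal := by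
    rcases hcase x hx with ⟨z, hz, hxz, hrx⟩ | ⟨-, u, -, hmin, hrx⟩
    · rcases le_or_gt (max (r x) 0) (max (r y) 0) with hle | hlt
      · linarith
      suffices rt z / 4 ≤ D x y by
        have := mul_le_mul_of_nonneg_left this hsq.le
        linarith
      rcases hcase y hy with ⟨w, hw, hyw, hry⟩ | ⟨hfar, w, hw, -, hry⟩
      · have hwz : rt w < rt z := by
          rw [hrx, hry] at hlt
          exact lt_of_mul_lt_mul_left hlt (by positivity)
        have hzw : z ≠ w := by
          rintro rfl
          exact hwz.false
        exact h.le_Dscale_of_near hI hρ (hsep z hz w hw hzw) hxz.le (hyw.le.trans (by linarith))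
      · have hyw : D y w < rt z / 4 := by
          rw [hrx, hry] at hlt
          exact lt_of_mul_lt_mul_left (by linarith) hsq.le
        have hzw : z ≠ w := by
          rintro rfl
          exact (hfar z hz).not_gt hyw
        exact h.le_Dscale_of_near hI hρ (hsep z hz w hw hzw) hxz.le hyw.le
    · obtain ⟨w, hw, hyw⟩ : ∃ w ∈ Ct, δ ^ 2 * D y w ≤ max (r y) 0 := by
        rcases hcase y hy with ⟨w, hw, hyw, hry⟩ | ⟨-, w, hw, -, hry⟩
        · have := mul_le_mul_of_nonneg_left hyw.le hsq.le
          exact ⟨w, hw, by linarith⟩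
        · exact ⟨w, hw, hry.ge⟩
      have h₁ := mul_le_mul_of_nonneg_left ((hmin w hw).trans (htri x y w)) hsq.le
      linarith
  rw [← ENNReal.ofReal_toReal (h.Dscale_ne_top hI hKR x y), ← ENNReal.ofReal_mul hδ0.le,
    ENNReal.ofReal_mul (by norm_num)]
  have hmax : ∀ a : ℝ, ENNReal.ofReal a = ENNReal.ofReal (max a 0) := fun a => by
    rw [ENNReal.ofReal_max, ENNReal.ofReal_zero, max_eq_left zero_le]
  rw [hmax (r x), hmax (r y), ← ENNReal.ofReal_mul (by norm_num),
    ← ENNReal.ofReal_add (by positivity) (mul_nonneg hδ0.le ENNReal.toReal_nonneg)]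
  exact ENNReal.ofReal_le_ofReal hmain
end
end
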